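/- arXiv:2007.10725 — 8 statements merged into one kernel-verified Lean document; each statement's English description precedes it below -/
import Mathlib

section
/- Let a₁, b₁, a₂, b₂ > 1 and let f_i(x) = x^{a_i−1}(1−x)^{b_i−1}/B(a_i,b_i) for x ∈ (0,1) and f_i(x) = 0 otherwise, be the Beta(a_i,b_i) probability density functions (B denoting the Beta function). Assume the two densities have the same mode, i.e. (a₁−1)/(a₁+b₁−2) = (a₂−1)/(a₂+b₂−2). Then sup_x f₁(x) ≤ sup_x f₂(x) if and only if f₁ ⪯ f₂, i.e. if and only if ∫_ℝ max(f₁(x)−c, 0) dx ≤ ∫_ℝ max(f₂(x)−c, 0) dx for every c > 0. -/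
open MeasureTheory Set

namespace ProbabilityTheory

lemma continuous_betaPDFReal {a b : ℝ} (ha : 1 < a) (hb : 1 < b) :
    Continuous (betaPDFReal a b) := by
  have h : betaPDFReal a b =
      fun x ↦ 1 / beta a b * (max x 0) ^ (a - 1) * (max (1 - x) 0) ^ (b - 1) := by
    ext x
    rw [betaPDFReal]
    have ha' : a - 1 ≠ 0 := by linarith
    have hb' : b - 1 ≠ 0 := by linarith
    split_ifs with hx
    · rw [max_eq_left hx.1.le, max_eq_left (by linarith [hx.2])]
    · rcases le_or_gt x 0 with h0 | h0
      · rw [max_eq_right h0, Real.zero_rpow ha']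
        simp
      · rw [max_eq_right (a := 1 - x) (by grind), Real.zero_rpow hb']
        simp
  rw [h]
  refine (continuous_const.mul ?_).mul ?_
  · exact (continuous_id.max continuous_const).rpow_const fun _ ↦ Or.inr (by linarith)
  · exact ((continuous_const.sub continuous_id).max continuous_const).rpow_const
      fun _ ↦ Or.inr (by linarith)

lemma betaPDFReal_eq_zero_of_notMem {a b x : ℝ} (hx : x ∉ Ioo (0 : ℝ) 1) :
    betaPDFReal a b x = 0 := by
  exact if_neg hx

lemma betaPDFReal_nonneg {a b : ℝ} (ha : 0 < a) (hb : 0 < b) (x : ℝ) : 0 ≤ betaPDFReal a b x := by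
  by_cases hx : x ∈ Ioo (0 : ℝ) 1
  · exact (betaPDFReal_pos hx.1 hx.2 ha hb).le
  · exact (betaPDFReal_eq_zero_of_notMem hx).ge

lemma hasCompactSupport_betaPDFReal (a b : ℝ) : HasCompactSupport (betaPDFReal a b) :=
  HasCompactSupport.intro isCompact_Icc fun _ hx ↦
    betaPDFReal_eq_zero_of_notMem fun h ↦ hx (Ioo_subset_Icc_self h)

lemma integrable_betaPDFReal {a b : ℝ} (ha : 1 < a) (hb : 1 < b) :
    Integrable (betaPDFReal a b) :=
  (continuous_betaPDFReal ha hb).integrable_of_hasCompactSupport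
    (hasCompactSupport_betaPDFReal a b)

lemma integral_betaPDFReal {a b : ℝ} (ha : 0 < a) (hb : 0 < b) :
    ∫ x, betaPDFReal a b x = 1 := by
  rw [integral_eq_lintegral_of_nonneg_ae (ae_of_all _ (betaPDFReal_nonneg ha hb))
    (stronglyMeasurable_betaPDFReal a b).aestronglyMeasurable]
  exact (ENNReal.toReal_eq_one_iff _).2 (lintegral_betaPDF_eq_one ha hb)

/-- On the unit interval, a Beta density is a power of a function that depends only on its mode. -/
lemma betaPDFReal_eq_rpow {a b m x : ℝ} (hab : 0 < a + b - 2) (hm : (a - 1) / (a + b - 2) = m)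
    (hx : x ∈ Ioo (0 : ℝ) 1) :
    betaPDFReal a b x = 1 / beta a b * (x ^ m * (1 - x) ^ (1 - m)) ^ (a + b - 2) := by
  have hx1 : 0 < 1 - x := sub_pos.2 hx.2
  have e1 : m * (a + b - 2) = a - 1 := by rw [← hm]; field_simp
  have e2 : (1 - m) * (a + b - 2) = b - 1 := by linarith
  rw [betaPDFReal, if_pos ⟨hx.1, hx.2⟩, Real.mul_rpow (Real.rpow_nonneg hx.1.le _)
    (Real.rpow_nonneg hx1.le _), ← Real.rpow_mul hx.1.le, ← Real.rpow_mul hx1.le, e1, e2, mul_assoc]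

end ProbabilityTheory

open ProbabilityTheory

lemma rpow_mul_one_sub_rpow_le {m x : ℝ} (hm : m ∈ Ioo (0 : ℝ) 1) (hx : x ∈ Ioo (0 : ℝ) 1) :
    x ^ m * (1 - x) ^ (1 - m) ≤ m ^ m * (1 - m) ^ (1 - m) := by
  have hm0 := hm.1
  have hm1 : 0 < 1 - m := sub_pos.2 hm.2
  have hx1 : 0 < 1 - x := sub_pos.2 hx.2
  have h := Real.geom_mean_le_arith_mean2_weighted hm0.le hm1.le
    (div_nonneg hx.1.le hm0.le) (div_nonneg hx1.le hm1.le) (by ring)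
  rw [mul_div_cancel₀ _ hm0.ne', mul_div_cancel₀ _ hm1.ne', Real.div_rpow hx.1.le hm0.le,
    Real.div_rpow hx1.le hm1.le, div_mul_div_comm, div_le_iff₀ (by positivity)] at h
  linarith

lemma ProbabilityTheory.betaPDFReal_le_mode {a b m : ℝ} (ha : 1 < a) (hb : 1 < b)
    (hm : (a - 1) / (a + b - 2) = m) (hm01 : m ∈ Ioo (0 : ℝ) 1) (x : ℝ) :
    betaPDFReal a b x ≤ betaPDFReal a b m := by
  by_cases hx : x ∈ Ioo (0 : ℝ) 1
  · rw [betaPDFReal_eq_rpow (by linarith) hm hx, betaPDFReal_eq_rpow (by linarith) hm hm01]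
    have := beta_pos (zero_lt_one.trans ha) (zero_lt_one.trans hb)
    have := hx.1
    have : 0 < 1 - x := sub_pos.2 hx.2
    gcongr ?_ * ?_ ^ ?_
    · linarith
    · exact rpow_mul_one_sub_rpow_le hm01 hx
  · rw [betaPDFReal_eq_zero_of_notMem hx]
    exact betaPDFReal_nonneg (by linarith) (by linarith) m

lemma integrable_max_sub_zero {f : ℝ → ℝ} (hf : Integrable f) (hf0 : ∀ x, 0 ≤ f x) {c : ℝ}
    (hc : 0 ≤ c) : Integrable fun x ↦ max (f x - c) 0 := by
  refine hf.mono' ((hf.aestronglyMeasurable.sub aestronglyMeasurable_const).sup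
    aestronglyMeasurable_const) (ae_of_all _ fun x ↦ ?_)
  have := hf0 x
  rw [Real.norm_eq_abs, abs_of_nonneg (le_max_right _ _)]
  exact max_le (by linarith) this

/-- Two densities of equal mass are ordered by majorisation as soon as the region where the second
exceeds the first lies above the remaining region, in terms of the values of the first. -/
lemma integral_max_sub_le_of_single_crossing {f g : ℝ → ℝ} (hf : Integrable f) (hg : Integrable g)
    (hf0 : ∀ x, 0 ≤ f x) (hg0 : ∀ x, 0 ≤ g x) (hfg : ∫ x, f x = ∫ x, g x)
    (hcross : ∀ x y, f y ≤ f x → f y < g y → f x ≤ g x) {c : ℝ} (hc : 0 ≤ c) :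
    ∫ x, max (f x - c) 0 ≤ ∫ x, max (g x - c) 0 := by
  have hfi := integrable_max_sub_zero hf hf0 hc
  have hgi := integrable_max_sub_zero hg hg0 hc
  by_cases hy : ∃ y, f y ≤ c ∧ f y < g y
  · obtain ⟨y, hyc, hyg⟩ := hy
    refine integral_mono hfi hgi fun x ↦ ?_
    rcases le_or_gt (f x) c with h | h
    · exact (max_eq_right (sub_nonpos.2 h)).trans_le (le_max_right _ _)
    · exact max_le_max_right 0 (sub_le_sub_right (hcross x y (hyc.trans h.le) hyg) c)
  · push Not at hy
    have key : ∫ x, (g x - max (g x - c) 0) ≤ ∫ x, (f x - max (f x - c) 0) := by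
      refine integral_mono (hg.sub hgi) (hf.sub hfi) fun x ↦ ?_
      have := hy x
      grind
    rw [integral_sub hg hgi, integral_sub hf hfi] at key
    linarith

lemma le_of_integral_max_sub_le {f g : ℝ → ℝ} (hf : Continuous f) (hfs : HasCompactSupport f)
    {m M : ℝ} (hM : 0 ≤ M) (hgM : ∀ x, g x ≤ M)
    (h : ∫ x, max (f x - M) 0 ≤ ∫ x, max (g x - M) 0) : f m ≤ M := by
  by_contra! hlt
  have hg0 : (fun x ↦ max (g x - M) 0) = fun _ ↦ 0 :=
    funext fun x ↦ max_eq_right (sub_nonpos.2 (hgM x))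
  have hpos : 0 < ∫ x, max (f x - M) 0 := by
    refine Continuous.integral_pos_of_hasCompactSupport_nonneg_nonzero (x := m)
      ((hf.sub continuous_const).max continuous_const) ?_ (fun x ↦ le_max_right _ _) ?_
    · exact hfs.comp_left (g := fun t ↦ max (t - M) 0) (by simpa using hM)
    · exact (lt_max_of_lt_left (sub_pos.2 hlt)).ne'
  rw [hg0, integral_zero] at h
  exact h.not_gt hpos

lemma betaPDFReal_single_crossing {a₁ b₁ a₂ b₂ m : ℝ} (ha₁ : 1 < a₁) (hb₁ : 1 < b₁)
    (ha₂ : 1 < a₂) (hb₂ : 1 < b₂) (hm₁ : (a₁ - 1) / (a₁ + b₁ - 2) = m)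
    (hm₂ : (a₂ - 1) / (a₂ + b₂ - 2) = m) (hle : a₁ + b₁ - 2 ≤ a₂ + b₂ - 2) (x y : ℝ)
    (hyx : betaPDFReal a₁ b₁ y ≤ betaPDFReal a₁ b₁ x)
    (hy : betaPDFReal a₁ b₁ y < betaPDFReal a₂ b₂ y) :
    betaPDFReal a₁ b₁ x < betaPDFReal a₂ b₂ x := by
  by_cases hy01 : y ∈ Ioo (0 : ℝ) 1
  swap
  · simp [betaPDFReal_eq_zero_of_notMem hy01] at hy
  by_cases hx01 : x ∈ Ioo (0 : ℝ) 1
  swap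
  · have := betaPDFReal_pos hy01.1 hy01.2 (zero_lt_one.trans ha₁) (zero_lt_one.trans hb₁)
    rw [betaPDFReal_eq_zero_of_notMem hx01] at hyx
    linarith
  have hB₁ := beta_pos (zero_lt_one.trans ha₁) (zero_lt_one.trans hb₁)
  have hB₂ := beta_pos (zero_lt_one.trans ha₂) (zero_lt_one.trans hb₂)
  have hn₁ : 0 < a₁ + b₁ - 2 := by linarith
  have hn₂ : 0 < a₂ + b₂ - 2 := by linarith
  rw [betaPDFReal_eq_rpow hn₁ hm₁ hy01, betaPDFReal_eq_rpow hn₁ hm₁ hx01] at hyx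
  rw [betaPDFReal_eq_rpow hn₁ hm₁ hy01, betaPDFReal_eq_rpow hn₂ hm₂ hy01] at hy
  rw [betaPDFReal_eq_rpow hn₁ hm₁ hx01, betaPDFReal_eq_rpow hn₂ hm₂ hx01]
  have hu : 0 < x ^ m * (1 - x) ^ (1 - m) :=
    mul_pos (Real.rpow_pos_of_pos hx01.1 _) (Real.rpow_pos_of_pos (sub_pos.2 hx01.2) _)
  have hv : 0 < y ^ m * (1 - y) ^ (1 - m) :=
    mul_pos (Real.rpow_pos_of_pos hy01.1 _) (Real.rpow_pos_of_pos (sub_pos.2 hy01.2) _)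
  generalize x ^ m * (1 - x) ^ (1 - m) = u at *
  generalize y ^ m * (1 - y) ^ (1 - m) = v at *
  have hvu : v ≤ u := by
    rwa [mul_le_mul_iff_right₀ (by positivity), Real.rpow_le_rpow_iff hv.le hu.le hn₁] at hyx
  obtain ⟨d, hd⟩ : ∃ d, a₂ + b₂ - 2 = d + (a₁ + b₁ - 2) := ⟨_, (sub_add_cancel _ _).symm⟩
  have hd0 : 0 ≤ d := by linarith
  rw [hd, Real.rpow_add hv, ← mul_assoc, mul_lt_mul_iff_left₀ (by positivity)] at hy
  rw [hd, Real.rpow_add hu, ← mul_assoc]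
  gcongr
  exact hy.trans_le (by gcongr)

theorem stmt_2 (a₁ b₁ a₂ b₂ : ℝ) (ha₁ : 1 < a₁) (hb₁ : 1 < b₁) (ha₂ : 1 < a₂) (hb₂ : 1 < b₂)
    (f₁ f₂ : ℝ → ℝ)
    (hf₁ : ∀ x, f₁ x = if x ∈ Set.Ioo (0:ℝ) 1 then
      x ^ (a₁ - 1) * (1 - x) ^ (b₁ - 1) / (Real.Gamma a₁ * Real.Gamma b₁ / Real.Gamma (a₁ + b₁))
      else 0)
    (hf₂ : ∀ x, f₂ x = if x ∈ Set.Ioo (0:ℝ) 1 then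
      x ^ (a₂ - 1) * (1 - x) ^ (b₂ - 1) / (Real.Gamma a₂ * Real.Gamma b₂ / Real.Gamma (a₂ + b₂))
      else 0)
    (hmode : (a₁ - 1) / (a₁ + b₁ - 2) = (a₂ - 1) / (a₂ + b₂ - 2)) :
    (⨆ x : ℝ, f₁ x) ≤ (⨆ x : ℝ, f₂ x) ↔
      ∀ c > 0, (∫ x : ℝ, max (f₁ x - c) 0) ≤ ∫ x : ℝ, max (f₂ x - c) 0 := by
  have e₁ : f₁ = betaPDFReal a₁ b₁ := by
    ext x
    rw [hf₁, betaPDFReal, beta]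
    exact if_congr Iff.rfl (by ring) rfl
  have e₂ : f₂ = betaPDFReal a₂ b₂ := by
    ext x
    rw [hf₂, betaPDFReal, beta]
    exact if_congr Iff.rfl (by ring) rfl
  clear hf₁ hf₂
  subst e₁ e₂
  obtain ⟨m, hm₂⟩ : ∃ m, (a₂ - 1) / (a₂ + b₂ - 2) = m := ⟨_, rfl⟩
  have hm₁ := hmode.trans hm₂
  have hm01 : m ∈ Ioo (0 : ℝ) 1 := by
    rw [← hm₂]
    exact ⟨div_pos (by linarith) (by linarith), (div_lt_one (by linarith)).2 (by linarith)⟩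
  have hle₁ := betaPDFReal_le_mode ha₁ hb₁ hm₁ hm01
  have hle₂ := betaPDFReal_le_mode ha₂ hb₂ hm₂ hm01
  have s₁ : ⨆ x, betaPDFReal a₁ b₁ x = betaPDFReal a₁ b₁ m :=
    le_antisymm (ciSup_le hle₁) (le_ciSup ⟨_, forall_mem_range.2 hle₁⟩ m)
  have s₂ : ⨆ x, betaPDFReal a₂ b₂ x = betaPDFReal a₂ b₂ m :=
    le_antisymm (ciSup_le hle₂) (le_ciSup ⟨_, forall_mem_range.2 hle₂⟩ m)
  have ha₁' := zero_lt_one.trans ha₁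
  have hb₁' := zero_lt_one.trans hb₁
  have ha₂' := zero_lt_one.trans ha₂
  have hb₂' := zero_lt_one.trans hb₂
  have hi₁ := integrable_betaPDFReal ha₁ hb₁
  have hi₂ := integrable_betaPDFReal ha₂ hb₂
  have h0₁ := betaPDFReal_nonneg ha₁' hb₁'
  have h0₂ := betaPDFReal_nonneg ha₂' hb₂'
  rw [s₁, s₂]
  constructor
  · intro h c hc
    rcases le_total (a₁ + b₁ - 2) (a₂ + b₂ - 2) with hn | hn
    · exact integral_max_sub_le_of_single_crossing hi₁ hi₂ h0₁ h0₂
        (by rw [integral_betaPDFReal ha₁' hb₁', integral_betaPDFReal ha₂' hb₂'])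
        (fun x y hyx hy ↦
          (betaPDFReal_single_crossing ha₁ hb₁ ha₂ hb₂ hm₁ hm₂ hn x y hyx hy).le) hc.le
    · refine integral_mono (integrable_max_sub_zero hi₁ h0₁ hc.le)
        (integrable_max_sub_zero hi₂ h0₂ hc.le) fun x ↦
          max_le_max_right 0 (sub_le_sub_right ?_ c)
      by_contra! hlt
      exact h.not_gt (betaPDFReal_single_crossing ha₂ hb₂ ha₁ hb₁ hm₂ hm₁ hn m x (hle₂ x) hlt)
  · intro h
    exact le_of_integral_max_sub_le (continuous_betaPDFReal ha₁ hb₁)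
      (hasCompactSupport_betaPDFReal a₁ b₁) (h0₂ m) hle₂
      (h _ (betaPDFReal_pos hm01.1 hm01.2 ha₂' hb₂'))
end

section
/- Let p(x) = 12(1−x)x² be the Beta(3,2) probability density on [0,1]. Suppose 0 ≤ z₁ < z₂ ≤ 1 satisfy p(z₁) = p(z₂) = y, and set z = z₂ − z₁. Then 48z⁶ − 96z⁴ + 9y² + 48z² − 16y = 0. -/
theorem stmt_3 (z₁ z₂ y z : ℝ) (h0 : 0 ≤ z₁) (h12 : z₁ < z₂) (h1 : z₂ ≤ 1)
    (hp1 : 12 * (1 - z₁) * z₁^2 = y) (hp2 : 12 * (1 - z₂) * z₂^2 = y)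
    (hz : z = z₂ - z₁) :
    48*z^6 - 96*z^4 + 9*y^2 + 48*z^2 - 16*y = 0 := by
  obtain ⟨s, hs⟩ : ∃ s, s = z₁ + z₂ := ⟨_, rfl⟩
  have hq : z₁ * z₂ = s ^ 2 - s := by
    have hne : z₂ - z₁ ≠ 0 := sub_ne_zero.mpr h12.ne'
    apply mul_left_cancel₀ hne
    subst hs
    linear_combination (hp2 - hp1) / 12
  have hw : z ^ 2 = 4 * s - 3 * s ^ 2 := by
    subst hs hz
    linear_combination -4 * hq
  have hy : y = 12 * s * (1 - s) ^ 2 := by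
    subst hs
    linear_combination -hp1 + 12 * (2 * z₁ + z₂ - 1) * hq
  calc
    48*z^6 - 96*z^4 + 9*y^2 + 48*z^2 - 16*y
        = 48 * z ^ 2 * (z ^ 2 - 1) ^ 2 + 9 * y ^ 2 - 16 * y := by ring
    _ = 0 := by
      rw [hw, hy]
      ring
end

section
/- Let p(x) = 12(1−x)x² be the Beta(3,2) probability density on [0,1] and F(x) = 4x³ − 3x⁴ its cumulative distribution function. Suppose 0 ≤ z₁ < z₂ ≤ 1 satisfy p(z₁) = p(z₂), and set z = z₂ − z₁. Then F(z₂) − F(z₁) = (z/9)·(√((4−3z²)³) + 8). -/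
theorem stmt_4 (z₁ z₂ z : ℝ) (h0 : 0 ≤ z₁) (h12 : z₁ < z₂) (h1 : z₂ ≤ 1)
    (hp : 12 * (1 - z₁) * z₁^2 = 12 * (1 - z₂) * z₂^2)
    (hz : z = z₂ - z₁) :
    (4*z₂^3 - 3*z₂^4) - (4*z₁^3 - 3*z₁^4) = (z/9) * (Real.sqrt ((4 - 3*z^2)^3) + 8) := by
  have hQ : z₁^2 + z₁*z₂ + z₂^2 = z₁ + z₂ := by
    apply mul_left_cancel₀ (sub_pos.mpr h12).ne'
    linear_combination hp / 12
  have hs : 1 ≤ z₁ + z₂ := by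
    by_contra! h
    nlinarith [mul_nonneg h0 (h0.trans h12.le), mul_pos (h0.trans_lt h12) (sub_pos.mpr h)]
  have hcube : (4 - 3*z^2)^3 = ((3*(z₁ + z₂) - 2)^3)^2 := by
    have hsq : 4 - 3*z^2 = (3*(z₁ + z₂) - 2)^2 := by
      subst hz
      linear_combination -12 * hQ
    rw [hsq]
    ring
  have hnonneg : 0 ≤ 3*(z₁ + z₂) - 2 := by linarith
  rw [hcube, Real.sqrt_sq (pow_nonneg hnonneg 3), hz]
  linear_combination (z₂ - z₁) * (4 - 6*(z₁ + z₂)) * hQ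
end

section
/- For an integer k ≥ 1, let V_k = π^{k/2}/Γ(k/2+1) and let F̃_k(z) = ∫_0^z (2π)^{−k/2} exp(−(1/2)(t/V_k)^{2/k}) dt be the cdf of the decreasing rearrangement of the k-variate standard normal density. Then for all integers 1 ≤ m < n and every z > 0, F̃_n(z) ≤ F̃_m(z); that is, the n-variate standard normal is majorised by the m-variate standard normal, so uncertainty increases with dimension. -/
open MeasureTheory Set

/-- The volume of the `k`-dimensional Euclidean unit ball. -/
noncomputable def unitBallVolume (k : ℕ) : ℝ :=
  Real.pi ^ ((k:ℝ)/2) / Real.Gamma ((k:ℝ)/2 + 1)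

/-- The decreasing rearrangement of the `k`-variate standard normal density. -/
noncomputable def gaussianRearrangement (k : ℕ) (t : ℝ) : ℝ :=
  (2 * Real.pi) ^ (-(k:ℝ)/2) * Real.exp (-(1/2) * (t / unitBallVolume k) ^ (2/(k:ℝ)))

lemma unitBallVolume_pos (k : ℕ) : 0 < unitBallVolume k :=
  div_pos (Real.rpow_pos_of_pos Real.pi_pos _) (Real.Gamma_pos_of_pos (by positivity))

/-- On `(0, ∞)` the rearrangement is a stretched exponential. -/
lemma gaussianRearrangement_eqOn (k : ℕ) :
    EqOn (gaussianRearrangement k) (fun t ↦ (2 * Real.pi) ^ (-(k:ℝ)/2) *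
      Real.exp (-((1/2) * (unitBallVolume k ^ (2/(k:ℝ)))⁻¹) * t ^ (2/(k:ℝ)))) (Ioi 0) := by
  intro t ht
  simp only [gaussianRearrangement]
  rw [Real.div_rpow (le_of_lt ht) (unitBallVolume_pos k).le]
  congr 2
  ring

lemma integral_gaussianRearrangement {k : ℕ} (hk : 1 ≤ k) :
    ∫ t in Ioi (0:ℝ), gaussianRearrangement k t = 1 := by
  have hV := unitBallVolume_pos k
  have hk0 : (0:ℝ) < k := by exact_mod_cast hk
  have hG : 0 < Real.Gamma ((k:ℝ)/2 + 1) := Real.Gamma_pos_of_pos (by positivity)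
  have hVp : 0 < unitBallVolume k ^ (2/(k:ℝ)) := Real.rpow_pos_of_pos hV _
  rw [setIntegral_congr_fun measurableSet_Ioi (gaussianRearrangement_eqOn k),
    integral_const_mul, integral_exp_neg_mul_rpow (by positivity) (by positivity)]
  have h1 : 1 / (2/(k:ℝ)) = k/2 := by field_simp
  have h2 : (1/2 * (unitBallVolume k ^ (2/(k:ℝ)))⁻¹) ^ (-1 / (2/(k:ℝ)))
      = 2 ^ ((k:ℝ)/2) * unitBallVolume k := by
    rw [neg_div, h1, Real.rpow_neg (by positivity), ← Real.inv_rpow (by positivity), mul_inv,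
      inv_inv, one_div, inv_inv, Real.mul_rpow (by positivity) hVp.le, ← Real.rpow_mul hV.le,
      show 2/(k:ℝ) * (k/2) = 1 by field_simp, Real.rpow_one]
  have h3 : unitBallVolume k * Real.Gamma ((k:ℝ)/2 + 1) = Real.pi ^ ((k:ℝ)/2) :=
    div_mul_cancel₀ _ hG.ne'
  rw [h2, h1, mul_assoc (2 ^ ((k:ℝ)/2) : ℝ), h3,
    ← Real.mul_rpow (by norm_num) Real.pi_pos.le, ← Real.rpow_add (by positivity),
    neg_div, neg_add_cancel, Real.rpow_zero]

lemma integrableOn_gaussianRearrangement {k : ℕ} (hk : 1 ≤ k) :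
    IntegrableOn (gaussianRearrangement k) (Ioi 0) :=
  Integrable.of_integral_ne_zero (by rw [integral_gaussianRearrangement hk]; exact one_ne_zero)

/-- The rearranged densities cross at most once on `(0, ∞)`, the lower-dimensional one being the
larger before the crossing. -/
lemma gaussianRearrangement_le_of_le {m n : ℕ} (hm : 1 ≤ m) (hmn : m < n) {s t : ℝ}
    (hs : 0 < s) (hst : s ≤ t) (h : gaussianRearrangement n t ≤ gaussianRearrangement m t) :
    gaussianRearrangement n s ≤ gaussianRearrangement m s := by
  have ht : 0 < t := hs.trans_le hst
  have hm0 : (0:ℝ) < m := by exact_mod_cast hm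
  have hmn' : (m:ℝ) < n := by exact_mod_cast hmn
  have hL : 0 ≤ Real.log (2 * Real.pi) :=
    Real.log_nonneg (by linarith [Real.pi_gt_three])
  have hexp (k : ℕ) (u : ℝ) : gaussianRearrangement k u =
      Real.exp (Real.log (2 * Real.pi) * (-(k:ℝ)/2) +
        -(1/2) * (u / unitBallVolume k) ^ (2/(k:ℝ))) := by
    rw [gaussianRearrangement, Real.rpow_def_of_pos (by positivity), Real.exp_add]
  have hscale (k : ℕ) : (s / unitBallVolume k) ^ (2/(k:ℝ)) =
      (s / t) ^ (2/(k:ℝ)) * (t / unitBallVolume k) ^ (2/(k:ℝ)) := by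
    have hV := unitBallVolume_pos k
    rw [← Real.mul_rpow (by positivity) (by positivity)]
    congr 1
    field_simp
  have hr1 : s / t ≤ 1 := (div_le_one ht).2 hst
  have hp1 : (s / t) ^ (2/(m:ℝ)) ≤ 1 := Real.rpow_le_one (by positivity) hr1 (by positivity)
  have hp0 : 0 ≤ (s / t) ^ (2/(m:ℝ)) := by positivity
  have hpq : (s / t) ^ (2/(m:ℝ)) ≤ (s / t) ^ (2/(n:ℝ)) :=
    Real.rpow_le_rpow_of_exponent_ge (by positivity) hr1 (by gcongr)
  have hB : 0 ≤ (t / unitBallVolume n) ^ (2/(n:ℝ)) :=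
    Real.rpow_nonneg (div_nonneg ht.le (unitBallVolume_pos n).le) _
  rw [hexp, hexp, Real.exp_le_exp] at h ⊢
  rw [hscale, hscale]
  have hC : 0 ≤ Real.log (2 * Real.pi) * ((n:ℝ) - m) := mul_nonneg hL (by linarith)
  have h' : (t / unitBallVolume m) ^ (2/(m:ℝ)) ≤
      Real.log (2 * Real.pi) * ((n:ℝ) - m) + (t / unitBallVolume n) ^ (2/(n:ℝ)) := by linarith
  have e1 := mul_le_mul_of_nonneg_left h' hp0
  have e2 := mul_le_mul_of_nonneg_right hp1 hC
  have e3 := mul_le_mul_of_nonneg_right hpq hB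
  linarith

/-- If the densities `f` and `g` on `(0, ∞)` have the same mass and `f ≤ g` persists to the left,
then the primitive of `f` is below that of `g`. -/
lemma integral_le_of_single_crossing {f g : ℝ → ℝ} (hf : IntegrableOn f (Ioi 0))
    (hg : IntegrableOn g (Ioi 0)) (hfg : ∫ t in Ioi (0:ℝ), f t = ∫ t in Ioi (0:ℝ), g t)
    (hcross : ∀ s t, 0 < s → s ≤ t → f t ≤ g t → f s ≤ g s) {z : ℝ} (hz : 0 < z) :
    ∫ t in (0:ℝ)..z, f t ≤ ∫ t in (0:ℝ)..z, g t := by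
  have hsub : Ioc 0 z ⊆ Ioi (0:ℝ) := fun t ht ↦ ht.1
  have hsub' : Ioi z ⊆ Ioi (0:ℝ) := Ioi_subset_Ioi hz.le
  rw [intervalIntegral.integral_of_le hz.le, intervalIntegral.integral_of_le hz.le]
  rcases le_or_gt (f z) (g z) with h | h
  · exact setIntegral_mono_on (hf.mono_set hsub) (hg.mono_set hsub) measurableSet_Ioc
      fun t ht ↦ hcross t z ht.1 ht.2 h
  · have htail : ∫ t in Ioi z, g t ≤ ∫ t in Ioi z, f t :=
      setIntegral_mono_on (hg.mono_set hsub') (hf.mono_set hsub') measurableSet_Ioi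
        fun t ht ↦ le_of_not_ge fun hle ↦ h.not_ge (hcross z t hz (le_of_lt ht) hle)
    have hsplit {u : ℝ → ℝ} (hu : IntegrableOn u (Ioi 0)) :
        ∫ t in Ioi (0:ℝ), u t = (∫ t in Ioc 0 z, u t) + ∫ t in Ioi z, u t := by
      rw [← setIntegral_union (Ioc_disjoint_Ioi le_rfl) measurableSet_Ioi
        (hu.mono_set hsub) (hu.mono_set hsub'), Ioc_union_Ioi_eq_Ioi hz.le]
    linarith [hsplit hf, hsplit hg]

theorem stmt_7 (F : ℕ → ℝ → ℝ)
    (hF : ∀ k : ℕ, 1 ≤ k → ∀ z, F k z =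
      ∫ t in (0:ℝ)..z, (2 * Real.pi) ^ (-(k:ℝ)/2) *
        Real.exp (-(1/2) * (t / (Real.pi ^ ((k:ℝ)/2) / Real.Gamma ((k:ℝ)/2 + 1))) ^ (2/(k:ℝ)))) :
    ∀ m n : ℕ, 1 ≤ m → m < n → ∀ z > 0, F n z ≤ F m z := by
  intro m n hm hmn z hz
  have hn : 1 ≤ n := hm.trans hmn.le
  rw [hF n hn, hF m hm]
  exact integral_le_of_single_crossing (integrableOn_gaussianRearrangement hn)
    (integrableOn_gaussianRearrangement hm)
    (by rw [integral_gaussianRearrangement hn, integral_gaussianRearrangement hm])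
    (fun _ _ hs hst h ↦ gaussianRearrangement_le_of_le hm hmn hs hst h) hz
end

section
/- For an integer k ≥ 1, let F̃_k(z) = ∫_0^z exp(−(k!·t)^{1/k}) dt be the cdf of the decreasing rearrangement of the k-fold independent standard exponential density. Then for all integers 1 ≤ m < n and every z > 0, F̃_n(z) ≤ F̃_m(z); that is, the n-fold standard exponential is majorised by the m-fold standard exponential, so uncertainty increases with dimension. -/
open MeasureTheory Set

/-- The decreasing rearrangement of the `k`-fold standard exponential density has total mass one. -/
theorem integral_Ioi_exp_neg_factorial_mul_rpow {k : ℕ} (hk : 1 ≤ k) :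
    ∫ t in Ioi (0:ℝ), Real.exp (-(((k.factorial : ℝ) * t) ^ ((1:ℝ) / (k:ℝ)))) = 1 := by
  have hk0 : (0:ℝ) < k := by exact_mod_cast hk
  have hfac : (0:ℝ) < k.factorial := by exact_mod_cast k.factorial_pos
  rw [integral_comp_mul_left_Ioi (fun t : ℝ => Real.exp (-(t ^ ((1:ℝ) / (k:ℝ))))) 0 hfac, mul_zero,
    integral_exp_neg_rpow (by positivity), one_div_one_div, Real.Gamma_nat_eq_factorial,
    smul_eq_mul, inv_mul_cancel₀ hfac.ne']

theorem integrableOn_Ioi_exp_neg_factorial_mul_rpow {k : ℕ} (hk : 1 ≤ k) :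
    IntegrableOn (fun t : ℝ => Real.exp (-(((k.factorial : ℝ) * t) ^ ((1:ℝ) / (k:ℝ)))))
      (Ioi 0) := by
  refine not_imp_comm.1 integral_undef ?_
  rw [integral_Ioi_exp_neg_factorial_mul_rpow hk]
  exact one_ne_zero

theorem mul_rpow_eq_mul_rpow_sub_mul_rpow {a t : ℝ} (ha : 0 < a) (ht : 0 < t) (p q : ℝ) :
    (a * t) ^ q = a ^ q * t ^ (q - p) * t ^ p := by
  rw [Real.mul_rpow ha.le ht.le, mul_assoc, ← Real.rpow_add ht, sub_add_cancel]

/-- Two integrable functions on `(0, ∞)` with equal integrals, the first lying below the second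
before `z` or above it after `z`, have ordered integrals up to `z`. -/
theorem setIntegral_Ioc_le_of_integral_Ioi_eq {f g : ℝ → ℝ} {z : ℝ} (hz : 0 < z)
    (hf : IntegrableOn f (Ioi 0)) (hg : IntegrableOn g (Ioi 0))
    (hfg : ∫ t in Ioi 0, f t = ∫ t in Ioi 0, g t)
    (h : (∀ t ∈ Ioc 0 z, f t ≤ g t) ∨ ∀ t ∈ Ioi z, g t ≤ f t) :
    ∫ t in Ioc 0 z, f t ≤ ∫ t in Ioc 0 z, g t := by
  have hsub : Ioi z ⊆ Ioi (0:ℝ) := Ioi_subset_Ioi hz.le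
  have split {u : ℝ → ℝ} (hu : IntegrableOn u (Ioi 0)) :
      ∫ t in Ioi 0, u t = (∫ t in Ioc 0 z, u t) + ∫ t in Ioi z, u t := by
    rw [← Ioc_union_Ioi_eq_Ioi hz.le]
    exact setIntegral_union Ioc_disjoint_Ioi_same measurableSet_Ioi
      (hu.mono_set Ioc_subset_Ioi_self) (hu.mono_set hsub)
  rcases h with h | h
  · exact setIntegral_mono_on (hf.mono_set Ioc_subset_Ioi_self) (hg.mono_set Ioc_subset_Ioi_self)
      measurableSet_Ioc h
  · have := setIntegral_mono_on (hg.mono_set hsub) (hf.mono_set hsub) measurableSet_Ioi h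
    rw [split hf, split hg] at hfg
    linarith

theorem stmt_8 (F : ℕ → ℝ → ℝ)
    (hF : ∀ k : ℕ, 1 ≤ k → ∀ z, F k z =
      ∫ t in (0:ℝ)..z, Real.exp (-(((k.factorial : ℝ) * t) ^ ((1:ℝ)/(k:ℝ))))) :
    ∀ m n : ℕ, 1 ≤ m → m < n → ∀ z > 0, F n z ≤ F m z := by
  intro m n hm hmn z hz
  have hn : 1 ≤ n := hm.trans hmn.le
  have hm0 : (0:ℝ) < m := by exact_mod_cast hm
  have hexp : 0 ≤ (1:ℝ) / m - 1 / n :=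
    sub_nonneg.2 (one_div_le_one_div_of_le hm0 (by exact_mod_cast hmn.le))
  have hmf : (0:ℝ) < m.factorial := by exact_mod_cast m.factorial_pos
  have hnf : (0:ℝ) < n.factorial := by exact_mod_cast n.factorial_pos
  rw [hF n hn, hF m hm, intervalIntegral.integral_of_le hz.le,
    intervalIntegral.integral_of_le hz.le]
  refine setIntegral_Ioc_le_of_integral_Ioi_eq hz (integrableOn_Ioi_exp_neg_factorial_mul_rpow hn)
    (integrableOn_Ioi_exp_neg_factorial_mul_rpow hm) ?_ ?_
  · rw [integral_Ioi_exp_neg_factorial_mul_rpow hn, integral_Ioi_exp_neg_factorial_mul_rpow hm]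
  · rcases le_total ((m.factorial : ℝ) ^ ((1:ℝ) / m) * z ^ ((1:ℝ) / m - 1 / n))
      ((n.factorial : ℝ) ^ ((1:ℝ) / n)) with h | h
    · refine Or.inl fun t ht => Real.exp_le_exp.2 (neg_le_neg ?_)
      have ht0 : 0 < t := ht.1
      rw [mul_rpow_eq_mul_rpow_sub_mul_rpow hmf ht0 (1 / n), Real.mul_rpow hnf.le ht0.le]
      refine mul_le_mul_of_nonneg_right (le_trans ?_ h) (by positivity)
      gcongr
      exact ht.2
    · refine Or.inr fun t ht => Real.exp_le_exp.2 (neg_le_neg ?_)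
      have ht0 : 0 < t := hz.trans ht
      rw [mul_rpow_eq_mul_rpow_sub_mul_rpow hmf ht0 (1 / n), Real.mul_rpow hnf.le ht0.le]
      refine mul_le_mul_of_nonneg_right (h.trans ?_) (by positivity)
      gcongr
      exact le_of_lt ht
end

section
/- For every real z ≥ 0, e^{−z} ≤ (1 + √(2z))·e^{−√(2z)} ≤ (1 + √z)·e^{−√z}. Equivalently, the decreasing-rearrangement cdfs F̃₁(z) = 1−e^{−z}, F̃₂(z) = 1−(1+√(2z))e^{−√(2z)} and F̃₄(z) = 1−(1+√z)e^{−√z} satisfy F̃₄(z) ≤ F̃₂(z) ≤ F̃₁(z) for all z ≥ 0, i.e. F̃₄ ⪯ F̃₂ ⪯ F̃₁ in the majorisation order. -/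
theorem exp_neg_sq_half_le_one_add_mul_exp_neg {s : ℝ} (hs : 0 ≤ s) :
    Real.exp (-(s ^ 2 / 2)) ≤ (1 + s) * Real.exp (-s) := by
  have hlog : s - s ^ 2 / 2 ≤ Real.log (1 + s) := by
    refine le_trans ?_ (Real.le_log_one_add_of_nonneg hs)
    rw [le_div_iff₀ (by positivity)]
    nlinarith [pow_nonneg hs 3]
  have hexp : Real.exp (s - s ^ 2 / 2) ≤ 1 + s :=
    (Real.le_log_iff_exp_le (by positivity)).1 hlog
  calc Real.exp (-(s ^ 2 / 2)) = Real.exp (s - s ^ 2 / 2) * Real.exp (-s) := by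
        rw [← Real.exp_add]; ring_nf
    _ ≤ (1 + s) * Real.exp (-s) := by gcongr

theorem one_add_mul_exp_neg_antitoneOn :
    AntitoneOn (fun x : ℝ => (1 + x) * Real.exp (-x)) (Set.Ici 0) := by
  intro a ha b _ hab
  have ha' : 0 ≤ a := ha
  have hexp : 1 + b ≤ (1 + a) * Real.exp (b - a) := by
    nlinarith [Real.add_one_le_exp (b - a), mul_nonneg ha' (sub_nonneg.2 hab)]
  calc (1 + b) * Real.exp (-b) ≤ (1 + a) * Real.exp (b - a) * Real.exp (-b) := by gcongr
    _ = (1 + a) * Real.exp (-a) := by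
        rw [mul_assoc, ← Real.exp_add]; ring_nf

theorem stmt_13 : ∀ z : ℝ, 0 ≤ z →
    Real.exp (-z) ≤ (1 + Real.sqrt (2*z)) * Real.exp (-Real.sqrt (2*z)) ∧
    (1 + Real.sqrt (2*z)) * Real.exp (-Real.sqrt (2*z)) ≤
      (1 + Real.sqrt z) * Real.exp (-Real.sqrt z) := by
  intro z hz
  constructor
  · have h := exp_neg_sq_half_le_one_add_mul_exp_neg (Real.sqrt_nonneg (2 * z))
    rwa [Real.sq_sqrt (by positivity), mul_div_cancel_left₀ z two_ne_zero] at h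
  · exact one_add_mul_exp_neg_antitoneOn (Real.sqrt_nonneg z) (Real.sqrt_nonneg (2 * z))
      (Real.sqrt_le_sqrt (by linarith))
end

section
/- Let h : ℝ → ℝ be a C¹ diffeomorphism (differentiable bijection with differentiable inverse) whose derivative satisfies 0 < |h′(x)| ≤ 1 for all x ∈ ℝ. Let f : ℝ → [0,∞) be a measurable probability density and let g(y) = f(h^{−1}(y))·|(h^{−1})′(y)| be the density of h(X) when X has density f. Then for every c > 0, ∫_ℝ max(f(x) − c, 0) dx ≤ ∫_ℝ max(g(y) − c, 0) dy; that is, f ⪯ g in the continuous majorisation (slice) ordering, so a volume-contractive mapping decreases uncertainty. -/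
open MeasureTheory

theorem integral_eq_integral_abs_deriv_mul_comp_of_bijective {h : ℝ → ℝ}
    (hd : Differentiable ℝ h) (hb : Function.Bijective h) (G : ℝ → ℝ) :
    ∫ y, G y = ∫ x, |deriv h x| * G (h x) := by
  have key := integral_image_eq_integral_abs_deriv_smul MeasurableSet.univ
    (fun x _ => (hd x).hasDerivAt.hasDerivWithinAt) hb.injective.injOn G
  simpa [Set.image_univ, hb.surjective.range_eq] using key

theorem abs_deriv_leftInverse_mul_abs_deriv {h hinv : ℝ → ℝ}
    (hd : Differentiable ℝ h) (hid : Differentiable ℝ hinv)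
    (hli : Function.LeftInverse hinv h) (x : ℝ) :
    |deriv hinv (h x)| * |deriv h x| = 1 := by
  have hcomp := (hid (h x)).hasDerivAt.comp x (hd x).hasDerivAt
  rw [hli.comp_eq_id] at hcomp
  rw [← abs_mul, hcomp.unique (hasDerivAt_id x), abs_one]

theorem stmt_16 (h hinv : ℝ → ℝ)
    (hdiff : ContDiff ℝ 1 h) (hinvdiff : ContDiff ℝ 1 hinv)
    (hli : Function.LeftInverse hinv h) (hri : Function.RightInverse hinv h)
    (hderiv : ∀ x, 0 < |deriv h x| ∧ |deriv h x| ≤ 1)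
    (f : ℝ → ℝ) (hfm : Measurable f) (hf0 : ∀ x, 0 ≤ f x)
    (hf1 : (∫ x, f x) = 1)
    (g : ℝ → ℝ) (hg : ∀ y, g y = f (hinv y) * |deriv hinv y|) :
    ∀ c > 0, (∫ x, max (f x - c) 0) ≤ ∫ y, max (g y - c) 0 := by
  intro c hc
  have hd : Differentiable ℝ h := hdiff.differentiable one_ne_zero
  have hid : Differentiable ℝ hinv := hinvdiff.differentiable one_ne_zero
  have hfi : Integrable f := .of_integral_ne_zero (by simp [hf1])
  have hpull (x : ℝ) :
      |deriv h x| * max (g (h x) - c) 0 = max (f x - c * |deriv h x|) 0 := by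
    rw [mul_max_of_nonneg _ _ (abs_nonneg _), mul_zero, hg, hli x]
    congr 1
    linear_combination f x * abs_deriv_leftInverse_mul_abs_deriv hd hid hli x
  rw [integral_eq_integral_abs_deriv_mul_comp_of_bijective hd ⟨hli.injective, hri.surjective⟩
    fun y => max (g y - c) 0]
  simp only [hpull]
  have hbound {u : ℝ → ℝ} (hu : Measurable u) (hu0 : ∀ x, 0 ≤ u x) :
      Integrable fun x => max (f x - u x) 0 := by
    refine hfi.mono' ((hfm.sub hu).max measurable_const).aestronglyMeasurable (.of_forall fun x => ?_)
    rw [Real.norm_of_nonneg (le_max_right _ _)]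
    exact max_le (sub_le_self _ (hu0 x)) (hf0 x)
  refine integral_mono (hbound measurable_const fun _ => hc.le)
    (hbound ((measurable_deriv h).abs.const_mul c) fun x => by positivity) fun x => ?_
  exact max_le_max_right 0 (sub_le_sub_left (mul_le_of_le_one_right hc.le (hderiv x).2) _)
end

section
/- Let α, β ∈ (0,1) and for ε ∈ ℝ define p₀₀(ε) = αβ + ε, p₀₁(ε) = α(1−β) − ε, p₁₀(ε) = (1−α)β − ε, p₁₁(ε) = (1−α)(1−β) + ε. Then the Tsallis entropy with γ = 1, T(ε) = Σ_{i,j} p_{ij}(ε)(1 − p_{ij}(ε)) = 1 − Σ_{i,j} p_{ij}(ε)², is a quadratic function of ε whose unique global maximum on ℝ occurs at ε* = −(1/4)(2α−1)(2β−1); equivalently, T′(ε) = 0 if and only if ε = ε*. In particular ε* = 0 if and only if α = 1/2 or β = 1/2. -/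
theorem stmt_18 (α β : ℝ) (hα : α ∈ Set.Ioo (0:ℝ) 1) (hβ : β ∈ Set.Ioo (0:ℝ) 1)
    (T : ℝ → ℝ)
    (hT : ∀ ε, T ε = (α*β + ε) * (1 - (α*β + ε)) + (α*(1-β) - ε) * (1 - (α*(1-β) - ε))
      + ((1-α)*β - ε) * (1 - ((1-α)*β - ε)) + ((1-α)*(1-β) + ε) * (1 - ((1-α)*(1-β) + ε)))
    (εstar : ℝ) (hε : εstar = -(1/4) * (2*α - 1) * (2*β - 1)) :
    (∀ ε, ε ≠ εstar → T ε < T εstar) ∧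
    (∀ ε, deriv T ε = 0 ↔ ε = εstar) ∧
    (εstar = 0 ↔ α = 1/2 ∨ β = 1/2) := by
  have key : ∀ ε, T ε = T εstar - 4 * (ε - εstar) ^ 2 := by
    intro ε
    rw [hT, hT, hε]
    ring
  refine ⟨fun ε hne => ?_, fun ε => ?_, ?_⟩
  · rw [key ε]
    have : 0 < (ε - εstar) ^ 2 := sq_pos_of_ne_zero (sub_ne_zero.2 hne)
    linarith
  · have hd : HasDerivAt T (-(8 * (ε - εstar))) ε := by
      rw [funext key]
      refine ((((hasDerivAt_id' ε).sub_const εstar).fun_pow 2).const_mul 4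
        |>.const_sub (T εstar)).congr_deriv ?_
      ring
    rw [hd.deriv, neg_eq_zero, mul_eq_zero, sub_eq_zero]
    norm_num
  · rw [hε, mul_eq_zero, mul_eq_zero]
    constructor
    · rintro ((h | h) | h)
      · norm_num at h
      · exact Or.inl (by linarith)
      · exact Or.inr (by linarith)
    · rintro (rfl | rfl) <;> norm_num
end
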